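/- arXiv:2410.05781 — 5 statements merged into one kernel-verified Lean document; each statement's English description precedes it below -/
import Mathlib

section
/- For all x = (x₁,x₂,x₃) ∈ ℝ³ the map Φ is differentiable at x, and its derivative DΦ(x) satisfies ‖DΦ(x)v‖² = v₁² + v₂² + (2(ρ+x₁)/h)² v₃² for every vector v = (v₁,v₂,v₃) ∈ ℝ³; that is, the pullback of the Euclidean metric under Φ at x is the diagonal form with entries 1, 1, (2(ρ+x₁)/h)². -/
open Real

/-- The covering map `Φ` of the toroid, defined on `ℝ³ = EuclideanSpace ℝ (Fin 3)` by
`Φ(x₁,x₂,x₃) = ((ρ+x₁)cos(2x₃/h), (ρ+x₁)sin(2x₃/h), x₂)`. -/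
noncomputable def Phi (ρ h : ℝ) (x : EuclideanSpace ℝ (Fin 3)) : EuclideanSpace ℝ (Fin 3) :=
  (EuclideanSpace.equiv (Fin 3) ℝ).symm
    ![(ρ + x 0) * Real.cos (2 * x 2 / h), (ρ + x 0) * Real.sin (2 * x 2 / h), x 1]

/-- The derivative of `Phi ρ h` at `x`, with components the differentials of the three
coordinate functions. -/
noncomputable def fderivPhi (ρ h : ℝ) (x : EuclideanSpace ℝ (Fin 3)) :
    EuclideanSpace ℝ (Fin 3) →L[ℝ] EuclideanSpace ℝ (Fin 3) :=
  ((EuclideanSpace.equiv (Fin 3) ℝ).symm : (Fin 3 → ℝ) →L[ℝ] EuclideanSpace ℝ (Fin 3)).comp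
    (ContinuousLinearMap.pi
      ![cos (2 * x 2 / h) • EuclideanSpace.proj 0
          - ((ρ + x 0) * sin (2 * x 2 / h) * (2 / h)) • EuclideanSpace.proj 2,
        sin (2 * x 2 / h) • EuclideanSpace.proj 0
          + ((ρ + x 0) * cos (2 * x 2 / h) * (2 / h)) • EuclideanSpace.proj 2,
        EuclideanSpace.proj 1])

theorem hasFDerivAt_Phi (ρ h : ℝ) (x : EuclideanSpace ℝ (Fin 3)) :
    HasFDerivAt (Phi ρ h) (fderivPhi ρ h x) x := by
  have hproj (i : Fin 3) : HasFDerivAt (fun y : EuclideanSpace ℝ (Fin 3) => y i)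
      (EuclideanSpace.proj i : EuclideanSpace ℝ (Fin 3) →L[ℝ] ℝ) x :=
    (EuclideanSpace.proj i : EuclideanSpace ℝ (Fin 3) →L[ℝ] ℝ).hasFDerivAt
  have hangle : HasFDerivAt (fun y : EuclideanSpace ℝ (Fin 3) => 2 * y 2 / h)
      ((2 / h) • (EuclideanSpace.proj 2 : EuclideanSpace ℝ (Fin 3) →L[ℝ] ℝ)) x := by
    simpa only [mul_div_right_comm] using (hproj 2).const_mul (2 / h)
  have hradius := (hproj 0).const_add ρ
  refine (EuclideanSpace.equiv (Fin 3) ℝ).symm.hasFDerivAt.comp x (hasFDerivAt_pi.2 fun i => ?_)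
  fin_cases i
  · refine (hradius.mul hangle.cos).congr_fderiv ?_
    ext v
    simp
    ring
  · refine (hradius.mul hangle.sin).congr_fderiv ?_
    ext v
    simp
    ring
  · exact hproj 1

theorem norm_fderivPhi_sq (ρ h : ℝ) (x v : EuclideanSpace ℝ (Fin 3)) :
    ‖fderivPhi ρ h x v‖ ^ 2 =
      (v 0) ^ 2 + (v 1) ^ 2 + (2 * (ρ + x 0) / h) ^ 2 * (v 2) ^ 2 := by
  rw [EuclideanSpace.real_norm_sq_eq, Fin.sum_univ_three]
  simp [fderivPhi]
  linear_combination ((v 0) ^ 2 + (2 * (ρ + x 0) / h) ^ 2 * (v 2) ^ 2) *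
    sin_sq_add_cos_sq (2 * x 2 / h)

/-- `Φ` is differentiable everywhere, and the pullback of the Euclidean metric under `Φ`
at `x` is the diagonal form with entries `1, 1, (2(ρ+x₁)/h)²`. -/
theorem stmt_0 (ρ h : ℝ) (hh : 0 < h) (x : EuclideanSpace ℝ (Fin 3)) :
    ∃ L : EuclideanSpace ℝ (Fin 3) →L[ℝ] EuclideanSpace ℝ (Fin 3),
      HasFDerivAt (Phi ρ h) L x ∧
        ∀ v : EuclideanSpace ℝ (Fin 3),
          ‖L v‖ ^ 2 = (v 0) ^ 2 + (v 1) ^ 2 + (2 * (ρ + x 0) / h) ^ 2 * (v 2) ^ 2 := by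
  exact ⟨fderivPhi ρ h x, hasFDerivAt_Phi ρ h x, norm_fderivPhi_sq ρ h x⟩
end

section
/- The function A(s) = ∫_{Ω_s} f_h(x) dx is strictly decreasing on (0,∞): for all real numbers 0 < s₁ < s₂ one has ∫_{Ω_{s₂}} f_h(x) dx < ∫_{Ω_{s₁}} f_h(x) dx. -/
open Real MeasureTheory

/-- The helicoid area element `f_h(x₁,x₂) = √(1 + h²/(x₁²+x₂²))`. -/
noncomputable def fh (h : ℝ) (p : ℝ × ℝ) : ℝ :=
  Real.sqrt (1 + h ^ 2 / (p.1 ^ 2 + p.2 ^ 2))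

/-- The laterally translated upper half-disc
`Ω_s = {(x₁,x₂) : (x₁−s)² + x₂² ≤ 1, x₂ > 0}`. -/
def Omega (s : ℝ) : Set (ℝ × ℝ) :=
  {p : ℝ × ℝ | (p.1 - s) ^ 2 + p.2 ^ 2 ≤ 1 ∧ 0 < p.2}

lemma integrableOn_abs_rpow_neg_half (a b : ℝ) :
    IntegrableOn (fun x : ℝ => |x| ^ (-(1 / 2) : ℝ)) (Set.Ioc a b) := by
  rcases le_total a b with hab | hab
  · rw [← intervalIntegrable_iff_integrableOn_Ioc_of_le hab]
    apply intervalIntegrable_of_even (fun x => by rw [abs_neg])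
    intro x hx
    refine (intervalIntegral.intervalIntegrable_rpow' (a := 0) (b := x)
      (r := (-(1 / 2) : ℝ)) (by norm_num)).congr ?_
    intro y hy
    rw [Set.uIoc_of_le hx.le] at hy
    simp only [abs_of_pos hy.1]
  · simp [Set.Ioc_eq_empty (not_lt.2 hab)]

lemma measurable_fh (h : ℝ) : Measurable (fh h) := by
  unfold fh
  fun_prop

lemma measurableSet_Omega (s : ℝ) : MeasurableSet (Omega s) :=
  MeasurableSet.inter
    (measurableSet_le (f := fun p : ℝ × ℝ => (p.1 - s) ^ 2 + p.2 ^ 2) (by fun_prop)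
      measurable_const)
    (measurableSet_lt measurable_const measurable_snd)

lemma fh_le {h : ℝ} (hh : 0 < h) {p : ℝ × ℝ} (h1 : p.1 ≠ 0) (h2 : p.2 ≠ 0) :
    fh h p ≤ 1 + h * (|p.1| ^ (-(1 / 2) : ℝ) * |p.2| ^ (-(1 / 2) : ℝ)) := by
  have hx := abs_pos.2 h1
  have hy := abs_pos.2 h2
  have hxy := mul_pos hx hy
  have key : (|p.1| ^ (-(1 / 2) : ℝ) * |p.2| ^ (-(1 / 2) : ℝ)) ^ 2 = 1 / (|p.1| * |p.2|) := by
    rw [← Real.mul_rpow hx.le hy.le, ← Real.rpow_natCast, ← Real.rpow_mul hxy.le]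
    norm_num [Real.rpow_neg_one]
  have hnn : 0 ≤ |p.1| ^ (-(1 / 2) : ℝ) * |p.2| ^ (-(1 / 2) : ℝ) := by positivity
  have hle : 1 / (p.1 ^ 2 + p.2 ^ 2) ≤ 1 / (|p.1| * |p.2|) := by
    apply one_div_le_one_div_of_le hxy
    nlinarith [sq_nonneg (|p.1| - |p.2|), sq_abs p.1, sq_abs p.2]
  apply Real.sqrt_le_iff.2 ⟨by positivity, ?_⟩
  have h3 : h ^ 2 / (p.1 ^ 2 + p.2 ^ 2) ≤ h ^ 2 * (1 / (|p.1| * |p.2|)) := by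
    rw [div_eq_mul_one_div]
    gcongr
  rw [← key] at h3
  nlinarith [mul_nonneg hh.le hnn]

lemma integrableOn_fh_Omega {h : ℝ} (hh : 0 < h) (s : ℝ) :
    IntegrableOn (fh h) (Omega s) := by
  have hsub : Omega s ⊆ Set.Ioc (s - 2) (s + 2) ×ˢ Set.Ioc (-2) 2 := by
    rintro ⟨x, y⟩ ⟨h1, h2⟩
    simp only at h1 h2
    refine ⟨⟨?_, ?_⟩, ?_, ?_⟩ <;> simp only <;> nlinarith [sq_nonneg (x - s), sq_nonneg y]
  refine IntegrableOn.mono_set ?_ hsub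
  have hprod : IntegrableOn
      (fun p : ℝ × ℝ => |p.1| ^ (-(1 / 2) : ℝ) * |p.2| ^ (-(1 / 2) : ℝ))
      (Set.Ioc (s - 2) (s + 2) ×ˢ Set.Ioc (-2) 2) := by
    have := (integrableOn_abs_rpow_neg_half (s - 2) (s + 2)).integrable.mul_prod
      (integrableOn_abs_rpow_neg_half (-2) 2).integrable
    rwa [Measure.prod_restrict] at this
  have hone : IntegrableOn (fun _ : ℝ × ℝ => (1 : ℝ))
      (Set.Ioc (s - 2) (s + 2) ×ˢ Set.Ioc (-2) 2) := by
    refine integrableOn_const ?_ (by simp)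
    rw [Measure.volume_eq_prod, Measure.prod_prod]
    simp [ENNReal.mul_eq_top]
  refine (hone.add (hprod.const_mul h)).mono' (measurable_fh h).aestronglyMeasurable ?_
  apply ae_restrict_of_ae
  have hfst : ∀ᵐ p : ℝ × ℝ, p.1 ≠ 0 :=
    Measure.quasiMeasurePreserving_fst.ae (Measure.ae_ne volume 0)
  have hsnd : ∀ᵐ p : ℝ × ℝ, p.2 ≠ 0 :=
    Measure.quasiMeasurePreserving_snd.ae (Measure.ae_ne volume 0)
  filter_upwards [hfst, hsnd] with p hp1 hp2
  rw [Real.norm_of_nonneg (show 0 ≤ fh h p from Real.sqrt_nonneg _)]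
  exact fh_le hh hp1 hp2

lemma fh_lt_fh {h : ℝ} (hh : 0 < h) {p q : ℝ × ℝ} (hp : 0 < p.1 ^ 2 + p.2 ^ 2)
    (hpq : p.1 ^ 2 + p.2 ^ 2 < q.1 ^ 2 + q.2 ^ 2) : fh h q < fh h p := by
  apply Real.sqrt_lt_sqrt (by positivity)
  gcongr

lemma volume_Omega_diff_pos {s₁ s₂ : ℝ} (hs : s₁ < s₂) :
    0 < volume (Omega s₁ \ Omega s₂) := by
  have hopen : IsOpen {p : ℝ × ℝ |
      ((p.1 - s₁) ^ 2 + p.2 ^ 2 < 1 ∧ 0 < p.2) ∧ 1 < (p.1 - s₂) ^ 2 + p.2 ^ 2} :=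
    IsOpen.inter
      (IsOpen.inter
        (isOpen_lt (f := fun p : ℝ × ℝ => (p.1 - s₁) ^ 2 + p.2 ^ 2) (by fun_prop)
          continuous_const)
        (isOpen_lt continuous_const continuous_snd))
      (isOpen_lt (g := fun p : ℝ × ℝ => (p.1 - s₂) ^ 2 + p.2 ^ 2) continuous_const (by fun_prop))
  refine (hopen.measure_pos volume ?_).trans_le (measure_mono ?_)
  · obtain ⟨t, ht1, ht2⟩ : ∃ t, max 0 (1 - (s₂ - s₁)) < t ∧ t < 1 :=
      exists_between (max_lt one_pos (by linarith))
    have ht0 := (le_max_left _ _).trans_lt ht1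
    have ht3 := (le_max_right _ _).trans_lt ht1
    refine ⟨(s₁ - t, (1 - t) / 2), ⟨?_, ?_⟩, ?_⟩ <;> simp only
    · nlinarith
    · linarith
    · nlinarith [sq_nonneg (1 - t)]
  · rintro p ⟨⟨h1, h2⟩, h3⟩
    exact ⟨⟨h1.le, h2⟩, fun h4 => h3.not_ge h4.1⟩

/-- Reflection of the plane across the vertical line `x₁ = c / 2`. -/
noncomputable def verticalReflection (c : ℝ) : ℝ × ℝ ≃ᵐ ℝ × ℝ :=
  (MeasurableEquiv.subLeft c).prodCongr (MeasurableEquiv.refl ℝ)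

lemma verticalReflection_apply (c : ℝ) (p : ℝ × ℝ) :
    verticalReflection c p = (c - p.1, p.2) := rfl

lemma measurePreserving_verticalReflection (c : ℝ) :
    MeasurePreserving (verticalReflection c) :=
  (Measure.measurePreserving_sub_left volume c).prod (MeasurePreserving.id volume)

lemma verticalReflection_preimage_Omega (c s : ℝ) :
    verticalReflection c ⁻¹' Omega s = Omega (c - s) := by
  ext p
  simp only [Set.mem_preimage, verticalReflection_apply, Omega, Set.mem_ofPred_eq]
  rw [show (c - p.1 - s) ^ 2 = (p.1 - (c - s)) ^ 2 by ring]

/-- The function `A(s) = ∫_{Ω_s} f_h` is strictly decreasing on `(0,∞)`. -/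
theorem stmt_9 (h : ℝ) (hh : 0 < h) (s₁ s₂ : ℝ) (hs₁ : 0 < s₁) (hs : s₁ < s₂) :
    ∫ p in Omega s₂, fh h p < ∫ p in Omega s₁, fh h p := by
  set R := verticalReflection (s₁ + s₂)
  have hR : MeasurePreserving R := measurePreserving_verticalReflection _
  have hpre : R ⁻¹' (Omega s₂ \ Omega s₁) = Omega s₁ \ Omega s₂ := by
    rw [Set.preimage_sdiff, verticalReflection_preimage_Omega, verticalReflection_preimage_Omega,
      add_sub_cancel_right, add_sub_cancel_left]
  have hi₁ := integrableOn_fh_Omega hh s₁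
  have hi₂ := integrableOn_fh_Omega hh s₂
  have hD := (measurableSet_Omega s₁).diff (measurableSet_Omega s₂)
  have hint : IntegrableOn (fh h) (Omega s₁ \ Omega s₂) := hi₁.mono_set Set.sdiff_subset
  have hintR : IntegrableOn (fun p => fh h (R p)) (Omega s₁ \ Omega s₂) := by
    rw [← hpre]
    exact (hR.integrableOn_comp_preimage R.measurableEmbedding).2 (hi₂.mono_set Set.sdiff_subset)
  have hlt : ∀ p ∈ Omega s₁ \ Omega s₂, fh h (R p) < fh h p := by
    rintro p ⟨⟨h1, h2⟩, h3⟩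
    have h4 : 1 < (p.1 - s₂) ^ 2 + p.2 ^ 2 := not_le.1 fun h4 => h3 ⟨h4, h2⟩
    have h5 : 2 * p.1 < s₁ + s₂ := by nlinarith
    apply fh_lt_fh hh (by positivity)
    simp only [R, verticalReflection_apply]
    nlinarith
  have hpos : 0 < ∫ p in Omega s₁ \ Omega s₂, (fh h p - fh h (R p)) := by
    refine (setIntegral_pos_iff_support_of_nonneg_ae ?_ (hint.sub hintR)).2 ?_
    · exact (ae_restrict_mem hD).mono fun p hp => (sub_pos.2 (hlt p hp)).le
    · exact (volume_Omega_diff_pos hs).trans_le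
        (measure_mono fun p hp => ⟨(sub_pos.2 (hlt p hp)).ne', hp⟩)
  rw [integral_sub hint hintR] at hpos
  have hrefl : ∫ p in Omega s₁ \ Omega s₂, fh h (R p) = ∫ p in Omega s₂ \ Omega s₁, fh h p := by
    rw [← hpre]
    exact hR.setIntegral_preimage_emb R.measurableEmbedding _ _
  have e₁ := integral_inter_add_sdiff (measurableSet_Omega s₂) hi₁
  have e₂ := integral_inter_add_sdiff (measurableSet_Omega s₁) hi₂
  rw [Set.inter_comm] at e₂
  linarith
end

section
/- For every h > 0, the Lebesgue integral of f_h over the closed unit disc B² satisfies ∫_{B²} √(1 + h²/(x₁²+x₂²)) dx = π·√(1+h²) + π·h²·log(h⁻¹ + √(h⁻² + 1)). (This is the area of one period of the rescaled helicoid hX inside the unit cylinder.) -/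
open Real MeasureTheory

/-- The antiderivative of `x ↦ √(x² + h²)`. -/
theorem hasDerivAt_sqrt_sq_add_sq_antideriv {h : ℝ} (hh : 0 < h) (x : ℝ) :
    HasDerivAt (fun x : ℝ => (x * √(x ^ 2 + h ^ 2) + h ^ 2 * arsinh (x / h)) / 2)
      (√(x ^ 2 + h ^ 2)) x := by
  have hpos : 0 < x ^ 2 + h ^ 2 := by positivity
  have hs : 0 < √(x ^ 2 + h ^ 2) := Real.sqrt_pos.2 hpos
  have hsq : √(x ^ 2 + h ^ 2) ^ 2 = x ^ 2 + h ^ 2 := Real.sq_sqrt hpos.le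
  have hdiv : √(1 + (x / h) ^ 2) = √(x ^ 2 + h ^ 2) / h := by
    rw [show 1 + (x / h) ^ 2 = (x ^ 2 + h ^ 2) / h ^ 2 by field_simp; ring,
      Real.sqrt_div hpos.le, Real.sqrt_sq hh.le]
  have h1 : HasDerivAt (fun x : ℝ => √(x ^ 2 + h ^ 2))
      (2 * x / (2 * √(x ^ 2 + h ^ 2))) x := by
    simpa using (((hasDerivAt_id x).pow 2).add_const (h ^ 2)).sqrt hpos.ne'
  have h2 := ((hasDerivAt_id x).div_const h).arsinh
  refine ((((hasDerivAt_id x).mul h1).add (h2.const_mul (h ^ 2))).div_const 2).congr_deriv ?_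
  simp only [id, smul_eq_mul, hdiv]
  field_simp
  linarith

theorem integral_sqrt_sq_add_sq {h : ℝ} (hh : 0 < h) (a b : ℝ) :
    ∫ x in a..b, √(x ^ 2 + h ^ 2)
      = (b * √(b ^ 2 + h ^ 2) + h ^ 2 * arsinh (b / h)) / 2
        - (a * √(a ^ 2 + h ^ 2) + h ^ 2 * arsinh (a / h)) / 2 :=
  intervalIntegral.integral_eq_sub_of_hasDerivAt
    (fun x _ => hasDerivAt_sqrt_sq_add_sq_antideriv hh x)
    (Continuous.intervalIntegrable (by fun_prop) a b)

/-- Polar coordinates for a function on the unit disc of `ℝ × ℝ`. -/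
theorem setIntegral_unitDisc_eq_polarCoord (f : ℝ × ℝ → ℝ) :
    ∫ p in {p : ℝ × ℝ | p.1 ^ 2 + p.2 ^ 2 ≤ 1}, f p
      = ∫ p in Set.Ioc (0 : ℝ) 1 ×ˢ Set.Ioo (-π) π, p.1 * f (polarCoord.symm p) := by
  have hD : MeasurableSet {p : ℝ × ℝ | p.1 ^ 2 + p.2 ^ 2 ≤ 1} :=
    measurableSet_le (by fun_prop) (by fun_prop)
  have hS : MeasurableSet (Set.Ioc (0 : ℝ) 1 ×ˢ Set.Ioo (-π) π) :=
    measurableSet_Ioc.prod measurableSet_Ioo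
  rw [← integral_indicator hD, ← integral_comp_polarCoord_symm,
    ← integral_indicator polarCoord.open_target.measurableSet, ← integral_indicator hS]
  congr 1
  ext ⟨r, θ⟩
  have hnorm : (r * cos θ) ^ 2 + (r * sin θ) ^ 2 = r ^ 2 := by
    linear_combination r ^ 2 * sin_sq_add_cos_sq θ
  have hle : 0 < r → (r ^ 2 ≤ 1 ↔ r ≤ 1) := fun hr => sq_le_one_iff₀ hr.le
  simp only [Set.indicator_apply, polarCoord_target, Set.mem_prod, Set.mem_Ioi, Set.mem_Ioc,
    Set.mem_ofPred_eq, polarCoord_symm_apply, hnorm, smul_eq_mul]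
  by_cases hr : 0 < r
  · by_cases hr1 : r ≤ 1 <;> simp [hr, hle hr, hr1]
  · simp [hr]

theorem mul_fh_polarCoord_symm (h : ℝ) {r : ℝ} (hr : 0 < r) (θ : ℝ) :
    r * fh h (polarCoord.symm (r, θ)) = √(r ^ 2 + h ^ 2) := by
  have hnorm : (r * cos θ) ^ 2 + (r * sin θ) ^ 2 = r ^ 2 := by
    linear_combination r ^ 2 * sin_sq_add_cos_sq θ
  rw [fh, polarCoord_symm_apply, hnorm,
    show 1 + h ^ 2 / r ^ 2 = (r ^ 2 + h ^ 2) / r ^ 2 by field_simp,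
    Real.sqrt_div (by positivity), Real.sqrt_sq hr.le]
  field_simp

/-- The area of one period of the rescaled helicoid `hX` inside the unit cylinder:
`∫_{B²} √(1 + h²/(x₁²+x₂²)) dx = π√(1+h²) + πh²·log(h⁻¹ + √(h⁻²+1))`. -/
theorem stmt_12 (h : ℝ) (hh : 0 < h) :
    ∫ p in {p : ℝ × ℝ | p.1 ^ 2 + p.2 ^ 2 ≤ 1}, fh h p
      = Real.pi * Real.sqrt (1 + h ^ 2)
        + Real.pi * h ^ 2 * Real.log (h⁻¹ + Real.sqrt (h⁻¹ ^ 2 + 1)) := by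
  have hcongr : ∫ p in Set.Ioc (0 : ℝ) 1 ×ˢ Set.Ioo (-π) π, p.1 * fh h (polarCoord.symm p)
      = ∫ p in Set.Ioc (0 : ℝ) 1 ×ˢ Set.Ioo (-π) π, √(p.1 ^ 2 + h ^ 2) * (1 : ℝ) :=
    setIntegral_congr_fun (measurableSet_Ioc.prod measurableSet_Ioo) fun p hp => by
      simpa using mul_fh_polarCoord_symm h hp.1.1 p.2
  have hangle : ∫ _ in Set.Ioo (-π) π, (1 : ℝ) = 2 * π := by
    simp [Measure.real, ← two_mul, pi_pos.le]
  rw [setIntegral_unitDisc_eq_polarCoord, hcongr, Measure.volume_eq_prod,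
    setIntegral_prod_mul (fun r : ℝ => √(r ^ 2 + h ^ 2)) (fun _ => (1 : ℝ)), hangle,
    ← intervalIntegral.integral_of_le zero_le_one, integral_sqrt_sq_add_sq hh]
  rw [one_div, zero_div, arsinh_zero, arsinh]
  ring_nf
end

section
/- The function h ↦ π·√(1+h²) + π·h²·log(h⁻¹ + √(h⁻² + 1)) is strictly increasing on (0,∞): for all real numbers 0 < h₁ < h₂, π·√(1+h₁²) + π·h₁²·log(h₁⁻¹ + √(h₁⁻² + 1)) < π·√(1+h₂²) + π·h₂²·log(h₂⁻¹ + √(h₂⁻² + 1)). -/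
open Real

theorem hasDerivAt_sqrt_add_sq_mul_arsinh_inv {h : ℝ} (hh : 0 < h) :
    HasDerivAt (fun x : ℝ => √(1 + x ^ 2) + x ^ 2 * arsinh x⁻¹) (2 * h * arsinh h⁻¹) h := by
  have hpos : 0 < 1 + h ^ 2 := by positivity
  have hsqrt : √(1 + h⁻¹ ^ 2) = √(1 + h ^ 2) / h := by
    rw [show 1 + h⁻¹ ^ 2 = (1 + h ^ 2) / h ^ 2 by field_simp; ring, sqrt_div hpos.le,
      sqrt_sq hh.le]
  have h_sqrt := (((hasDerivAt_id h).pow 2).const_add 1).sqrt hpos.ne'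
  have h_arsinh := ((hasDerivAt_id h).pow 2).mul (hasDerivAt_inv hh.ne').arsinh
  refine (h_sqrt.add h_arsinh).congr_deriv ?_
  have hne : √(1 + h ^ 2) ≠ 0 := (sqrt_pos.2 hpos).ne'
  simp only [hsqrt, smul_eq_mul, id, Pi.pow_apply, Nat.cast_ofNat]
  field_simp
  ring

theorem strictMonoOn_sqrt_add_sq_mul_arsinh_inv :
    StrictMonoOn (fun x : ℝ => √(1 + x ^ 2) + x ^ 2 * arsinh x⁻¹) (Set.Ioi 0) := by
  refine strictMonoOn_of_deriv_pos (convex_Ioi 0)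
    (fun x hx => (hasDerivAt_sqrt_add_sq_mul_arsinh_inv hx).continuousAt.continuousWithinAt) ?_
  intro x hx
  rw [interior_Ioi] at hx
  have hx_pos : 0 < x := hx
  rw [(hasDerivAt_sqrt_add_sq_mul_arsinh_inv hx_pos).deriv]
  exact mul_pos (by positivity) (arsinh_pos_iff.2 (inv_pos.2 hx_pos))

/-- The helicoid-period area `h ↦ π√(1+h²) + πh²·log(h⁻¹ + √(h⁻²+1))` is strictly
increasing on `(0,∞)`. -/
theorem stmt_14 (h₁ h₂ : ℝ) (hh₁ : 0 < h₁) (hh : h₁ < h₂) :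
    Real.pi * Real.sqrt (1 + h₁ ^ 2)
        + Real.pi * h₁ ^ 2 * Real.log (h₁⁻¹ + Real.sqrt (h₁⁻¹ ^ 2 + 1))
      < Real.pi * Real.sqrt (1 + h₂ ^ 2)
        + Real.pi * h₂ ^ 2 * Real.log (h₂⁻¹ + Real.sqrt (h₂⁻¹ ^ 2 + 1)) := by
  have key := mul_lt_mul_of_pos_left
    (strictMonoOn_sqrt_add_sq_mul_arsinh_inv hh₁ (hh₁.trans hh) hh) pi_pos
  simpa only [arsinh, mul_add, mul_assoc, add_comm (1 : ℝ) (_⁻¹ ^ 2)] using key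
end

section
/- For every real h with 0 < h ≤ 4/5 one has π·√(1+h²) + π·h²·log(h⁻¹ + √(h⁻² + 1)) < 2π. -/
open Real

/-- For `0 < h ≤ 4/5`, the helicoid-period area satisfies
`π√(1+h²) + πh²·log(h⁻¹ + √(h⁻²+1)) < 2π`. -/
theorem stmt_15 (h : ℝ) (hh : 0 < h) (hh' : h ≤ 4 / 5) :
    Real.pi * Real.sqrt (1 + h ^ 2)
        + Real.pi * h ^ 2 * Real.log (h⁻¹ + Real.sqrt (h⁻¹ ^ 2 + 1))
      < 2 * Real.pi := by
  have sqrt_eq : √(h⁻¹ ^ 2 + 1) = √(1 + h ^ 2) / h := by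
    rw [show h⁻¹ ^ 2 + 1 = (1 + h ^ 2) / h ^ 2 by field_simp,
      Real.sqrt_div (by positivity), Real.sqrt_sq hh.le]
  rw [sqrt_eq]
  have sqrt_le : √(1 + h ^ 2) ≤ 13 / 10 := Real.sqrt_le_iff.2 ⟨by norm_num, by nlinarith⟩
  have sqrt_nonneg := Real.sqrt_nonneg (1 + h ^ 2)
  generalize √(1 + h ^ 2) = s at *
  have u_pos : 0 < h⁻¹ + s / h := by positivity
  have log_le : log (h⁻¹ + s / h) ≤ (h⁻¹ + s / h) / (27 / 10) := by
    have := Real.log_le_sub_one_of_pos (div_pos u_pos (exp_pos 1))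
    rw [Real.log_div u_pos.ne' (exp_pos 1).ne', Real.log_exp] at this
    have : (h⁻¹ + s / h) / exp 1 ≤ (h⁻¹ + s / h) / (27 / 10) := by
      gcongr
      linarith [Real.exp_one_gt_d9]
    linarith
  have mul_log_le : h ^ 2 * log (h⁻¹ + s / h) ≤ h * (1 + s) / (27 / 10) :=
    calc h ^ 2 * log (h⁻¹ + s / h) ≤ h ^ 2 * ((h⁻¹ + s / h) / (27 / 10)) := by gcongr
      _ = h * (1 + s) / (27 / 10) := by field_simp
  have sum_lt : s + h ^ 2 * log (h⁻¹ + s / h) < 2 := by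
    have : h * (1 + s) ≤ 4 / 5 * (23 / 10) := by
      gcongr
      linarith
    linarith
  nlinarith [Real.pi_pos]
end
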